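/- Let k be a commutative ring, V a k-module, and R : V⊗V → V⊗V a linear map satisfying the Yang–Baxter equation (R⊗1)(1⊗R)(R⊗1) = (1⊗R)(R⊗1)(1⊗R) (invertibility of R is not assumed). For m ≥ 2 and 1 ≤ i ≤ m−1 let σ_{m,i} = 1^{⊗(i−1)}⊗R⊗1^{⊗(m−i−1)} : V^{⊗m} → V^{⊗m}. For n ≥ 1 and φ : V^{⊗n} → V^{⊗n}, define for 1 ≤ i ≤ n+1: d_{YB,i}^n(φ) = σ_{n+1,i−1}···σ_{n+1,2}σ_{n+1,1}(1⊗φ)σ_{n+1,1}···σ_{n+1,n−i}σ_{n+1,n−i+1} − σ_{n+1,i}···σ_{n+1,n−1}σ_{n+1,n}(φ⊗1)σ_{n+1,n}···σ_{n+1,n−i+3}σ_{n+1,n−i+2}, where empty products of σ's are identity maps, and set d^n_YB = Σ_{i=1}^{n+1}(−1)^{i+1}d_{YB,i}^n. Then for every n ≥ 1, d^{n+1}_YB ∘ d^n_YB = 0; that is, (Hom(V^{⊗n}, V^{⊗n}), d^n_YB) is a cochain complex. -/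

import Mathlib

open TensorProduct LinearMap

noncomputable section

universe u v

variable (k : Type u) [CommRing k] (V : Type v) [AddCommGroup V] [Module k V]

/-- The tower of tensor powers of `V`: `TPobj n` is `V^{⊗(n+1)}`,
associated to the left. -/
def TPobj : ℕ → ModuleCat.{v} k
  | 0 => ModuleCat.of k V
  | n + 1 => ModuleCat.of k ((TPobj n) ⊗[k] V)

/-- `TP k V n` is the `(n+1)`-st tensor power `V^{⊗(n+1)}` of `V`. -/
abbrev TP (n : ℕ) : Type v := (TPobj k V n : Type v)

variable {k V}

/-- `σ_{n+1,i}`: a braiding `R` acting on the `i`-th and `(i+1)`-st tensor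
factors of `TP k V n = V^{⊗(n+1)}` (the identity if `i` is out of range). -/
def sigmaMap (R : V ⊗[k] V →ₗ[k] V ⊗[k] V) :
    (n : ℕ) → ℕ → (TP k V n →ₗ[k] TP k V n)
  | 0, _ => LinearMap.id
  | 1, i => if i = 1 then (R : TP k V 1 →ₗ[k] TP k V 1) else LinearMap.id
  | (m + 2), i =>
    if i = m + 2 then
      (TensorProduct.assoc k (TP k V m) V V).symm.toLinearMap ∘ₗ
        R.lTensor (TP k V m) ∘ₗ (TensorProduct.assoc k (TP k V m) V V).toLinearMap
    else (sigmaMap R (m + 1) i).rTensor V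

/-- Composition `σ_{n+1,l₁} ∘ σ_{n+1,l₂} ∘ ⋯` over a list of indices. -/
def sigmaComp (R : V ⊗[k] V →ₗ[k] V ⊗[k] V) (n : ℕ) (l : List ℕ) :
    TP k V n →ₗ[k] TP k V n :=
  l.foldr (fun i acc => sigmaMap R n i ∘ₗ acc) LinearMap.id

/-- The canonical isomorphism `V ⊗ V^{⊗(n+1)} ≅ V^{⊗(n+2)}` prepending a
tensor factor on the left. -/
def lcons : (n : ℕ) → (V ⊗[k] TP k V n ≃ₗ[k] TP k V (n + 1))
  | 0 => LinearEquiv.refl k (V ⊗[k] V)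
  | n + 1 =>
    (TensorProduct.assoc k V (TP k V n) V).symm ≪≫ₗ
      TensorProduct.congr (lcons n) (LinearEquiv.refl k V)

/-- `1 ⊗ φ : V^{⊗(p+2)} → V^{⊗(q+2)}` for `φ : V^{⊗(p+1)} → V^{⊗(q+1)}`. -/
def oneTensor {p q : ℕ} (φ : TP k V p →ₗ[k] TP k V q) :
    TP k V (p + 1) →ₗ[k] TP k V (q + 1) :=
  (lcons q).toLinearMap ∘ₗ φ.lTensor V ∘ₗ (lcons p).symm.toLinearMap

/-- `φ ⊗ 1 : V^{⊗(p+2)} → V^{⊗(q+2)}` for `φ : V^{⊗(p+1)} → V^{⊗(q+1)}`. -/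
def tensorOne {p q : ℕ} (φ : TP k V p →ₗ[k] TP k V q) :
    TP k V (p + 1) →ₗ[k] TP k V (q + 1) :=
  φ.rTensor V

/-- The partial Yang-Baxter differential `d_{YB,i}^n` (with `n = p + 1`),
`d_{YB,i}^n(φ) = σ_{n+1,i−1}⋯σ_{n+1,1}(1⊗φ)σ_{n+1,1}⋯σ_{n+1,n−i+1}
  − σ_{n+1,i}⋯σ_{n+1,n}(φ⊗1)σ_{n+1,n}⋯σ_{n+1,n−i+2}`. -/
def dYBi (R : V ⊗[k] V →ₗ[k] V ⊗[k] V) (p : ℕ) (i : ℕ)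
    (φ : TP k V p →ₗ[k] TP k V p) : TP k V (p + 1) →ₗ[k] TP k V (p + 1) :=
  sigmaComp R (p + 1) ((List.range' 1 (i - 1)).reverse) ∘ₗ oneTensor φ ∘ₗ
      sigmaComp R (p + 1) (List.range' 1 ((p + 2) - i))
    - sigmaComp R (p + 1) (List.range' i ((p + 2) - i)) ∘ₗ tensorOne φ ∘ₗ
      sigmaComp R (p + 1) ((List.range' (((p + 2) - i) + 1) (i - 1)).reverse)

/-- The Yang-Baxter differential `d^n_YB = Σ_{i=1}^{n+1} (−1)^{i+1} d_{YB,i}^n`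
(with `n = p + 1`). -/
def dYB (R : V ⊗[k] V →ₗ[k] V ⊗[k] V) (p : ℕ)
    (φ : TP k V p →ₗ[k] TP k V p) : TP k V (p + 1) →ₗ[k] TP k V (p + 1) :=
  ∑ j ∈ Finset.range (p + 2), ((-1 : ℤ) ^ j) • dYBi R p (j + 1) φ

/-- Artin's braid relations among `s 1, …, s N`. -/
structure BraidRelations {M : Type*} [Monoid M] (s : ℕ → M) (N : ℕ) : Prop where
  comm : ∀ i j, 1 ≤ i → i + 2 ≤ j → j ≤ N → s i * s j = s j * s i
  braid : ∀ i, 1 ≤ i → i + 1 ≤ N → s i * s (i + 1) * s i = s (i + 1) * s i * s (i + 1)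

namespace BraidRelations

open List

variable {M : Type*} [Monoid M] {s : ℕ → M} {N : ℕ}

theorem op (h : BraidRelations s N) : BraidRelations (fun i => MulOpposite.op (s i)) N where
  comm i j hi hij hj := by
    simp only [← MulOpposite.op_mul, h.comm i j hi hij hj]
  braid i hi hN := by
    simp only [← MulOpposite.op_mul, ← mul_assoc, h.braid i hi hN]

theorem prod_map_op (s : ℕ → M) (l : List ℕ) :
    (l.map fun i => MulOpposite.op (s i)).prod = MulOpposite.op (l.reverse.map s).prod := by
  induction l with
  | nil => simp
  | cons a l ih => simp [ih]

theorem prod_mul_prod_comm (h : BraidRelations s N) {l l' : List ℕ}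
    (hl : ∀ i ∈ l, 1 ≤ i) (hl' : ∀ j ∈ l', j ≤ N) (hll' : ∀ i ∈ l, ∀ j ∈ l', i + 2 ≤ j) :
    (l.map s).prod * (l'.map s).prod = (l'.map s).prod * (l.map s).prod := by
  refine Commute.list_prod_left _ _ fun x hx => Commute.list_prod_right _ _ fun y hy => ?_
  obtain ⟨i, hi, rfl⟩ := List.mem_map.1 hx
  obtain ⟨j, hj, rfl⟩ := List.mem_map.1 hy
  exact h.comm i j (hl i hi) (hll' i hi j hj) (hl' j hj)

theorem prod_Ico_mul (h : BraidRelations s N) {a b c : ℕ} (ha : 1 ≤ a) (hb : b ≤ N + 1)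
    (hac : a ≤ c) (hcb : c + 2 ≤ b) :
    ((Ico a b).map s).prod * s c = s (c + 1) * ((Ico a b).map s).prod := by
  have hsplit : Ico a b = Ico a c ++ (c :: (c + 1) :: Ico (c + 2) b) := by
    rw [← Ico.append_consecutive hac (by omega : c ≤ b), Ico.eq_cons (by omega : c < b),
      Ico.eq_cons (by omega : c + 1 < b)]
  have h1 := h.prod_mul_prod_comm (l := Ico a c) (l' := [c + 1])
    (by simp; omega) (by simp; omega) (by simp)
  have h2 := h.prod_mul_prod_comm (l := [c]) (l' := Ico (c + 2) b)
    (by simp; omega) (by simp; omega) (by simp; omega)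
  have h3 := h.braid c (by omega) (by omega)
  simp only [map_cons, map_nil, prod_cons, prod_nil, mul_one] at h1 h2
  simp only [hsplit, map_append, map_cons, prod_append, prod_cons, mul_assoc, ← h2]
  rw [← mul_assoc (s (c + 1)) _ (s c * _), ← h1, mul_assoc]
  simp only [← mul_assoc (s c), ← mul_assoc (s (c + 1)), h3]

theorem prod_Ico_mul_prod (h : BraidRelations s N) {a b : ℕ} (ha : 1 ≤ a) (hb : b ≤ N + 1)
    {l : List ℕ} (hl : ∀ c ∈ l, a ≤ c ∧ c + 2 ≤ b) :
    ((Ico a b).map s).prod * (l.map s).prod =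
      ((l.map (· + 1)).map s).prod * ((Ico a b).map s).prod := by
  induction l with
  | nil => simp
  | cons c l ih =>
    have hc := hl c (by simp)
    simp only [map_cons, prod_cons, mul_assoc, ← ih fun d hd => hl d (by simp [hd])]
    rw [← mul_assoc, h.prod_Ico_mul ha hb hc.1 hc.2, mul_assoc]

theorem map_succ_Ico (a b : ℕ) : (Ico a b).map (· + 1) = Ico (a + 1) (b + 1) := by
  simpa [add_comm] using Ico.map_add a b 1

theorem prod_Ico_mul_prod_Ico (h : BraidRelations s N) {a b c d : ℕ} (ha : 1 ≤ a)
    (hb : b ≤ N + 1) (hac : a ≤ c) (hdb : d + 1 ≤ b) :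
    ((Ico a b).map s).prod * ((Ico c d).map s).prod =
      ((Ico (c + 1) (d + 1)).map s).prod * ((Ico a b).map s).prod := by
  rw [h.prod_Ico_mul_prod ha hb (by simp; omega), map_succ_Ico]

theorem prod_reverse_Ico_mul (h : BraidRelations s N) {a b c d : ℕ} (ha : 1 ≤ a)
    (hb : b ≤ N + 1) (hac : a ≤ c) (hdb : d + 1 ≤ b) :
    ((Ico c d).reverse.map s).prod * ((Ico a b).reverse.map s).prod =
      ((Ico a b).reverse.map s).prod * ((Ico (c + 1) (d + 1)).reverse.map s).prod := by
  simpa only [prod_map_op, ← MulOpposite.op_mul, MulOpposite.op_inj] using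
    h.op.prod_Ico_mul_prod_Ico ha hb hac hdb

theorem prod_Ico_mul_reverse (h : BraidRelations s N) {i j m : ℕ} (hi : 1 ≤ i) (hij : i ≤ j)
    (hjm : j < m) (hm : m ≤ N + 1) :
    ((Ico i m).map s).prod * ((Ico 1 j).reverse.map s).prod =
      ((Ico 1 (j + 1)).reverse.map s).prod * ((Ico (i + 1) m).map s).prod := by
  have h1 := h.prod_Ico_mul_prod (a := i) (b := m) hi hm (l := (Ico i j).reverse)
    (by simp; omega)
  rw [map_reverse (f := (· + 1)), map_succ_Ico] at h1
  have h2 := h.prod_mul_prod_comm (l := (Ico 1 i).reverse) (l' := Ico (i + 1) m)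
    (by simp; omega) (by simp; omega) (by simp; omega)
  rw [← Ico.append_consecutive hi hij, ← Ico.append_consecutive hi (by omega : i ≤ j + 1),
    reverse_append, reverse_append, map_append, map_append, prod_append, prod_append,
    ← mul_assoc, h1, Ico.eq_cons (by omega : i < m), Ico.eq_cons (by omega : i < j + 1),
    mul_assoc _ (List.prod _) (List.prod _), mul_assoc _ (List.prod _) (List.prod _), h2]
  simp only [map_cons, reverse_cons, map_append, prod_append, prod_cons, map_nil, prod_nil,
    mul_one, mul_assoc]

theorem prod_Ico_mul_reverse_Ico (h : BraidRelations s N) {i j m : ℕ} (hi : 1 ≤ i) (hij : i ≤ j)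
    (hjm : j < m) (hm : m ≤ N + 1) :
    ((Ico 1 j).map s).prod * ((Ico i m).reverse.map s).prod =
      ((Ico (i + 1) m).reverse.map s).prod * ((Ico 1 (j + 1)).map s).prod := by
  simpa only [prod_map_op, ← MulOpposite.op_mul, MulOpposite.op_inj, reverse_reverse] using
    h.op.prod_Ico_mul_reverse hi hij hjm hm

end BraidRelations

/-- Alternating double sums vanish under the cosimplicial identities. -/
theorem sum_sum_neg_one_pow_smul_eq_zero {A : Type*} [AddCommGroup A] (n : ℕ) (f : ℕ → ℕ → A)
    (hf : ∀ i j, i < j → j < n + 1 → f j i = f i (j - 1)) :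
    ∑ j ∈ Finset.range (n + 1), ∑ i ∈ Finset.range n, ((-1 : ℤ) ^ (j + i)) • f j i = 0 := by
  rw [← Finset.sum_product']
  refine Finset.sum_involution
    (fun x _ => if x.2 < x.1 then (x.2, x.1 - 1) else (x.2 + 1, x.1)) ?_ ?_ ?_ ?_
  · rintro ⟨j, i⟩ hx
    simp only [Finset.mem_product, Finset.mem_range] at hx
    split_ifs with hij
    · obtain ⟨j, rfl⟩ : ∃ j', j = j' + 1 := ⟨j - 1, by simp at hij; omega⟩
      have := hf i (j + 1) hij hx.1
      simp only [this, Nat.add_sub_cancel, ← add_smul]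
      rw [show (-1 : ℤ) ^ (j + 1 + i) + (-1) ^ (i + j) = 0 by ring, zero_smul]
    · have := hf j (i + 1) (by simp at hij; omega) (by omega)
      simp only [this, Nat.add_sub_cancel, ← add_smul]
      rw [show (-1 : ℤ) ^ (j + i) + (-1) ^ (i + 1 + j) = 0 by ring, zero_smul]
  · rintro ⟨j, i⟩ hx _
    split_ifs with hij <;> simp only [ne_eq, Prod.mk.injEq] at hij ⊢ <;> omega
  · rintro ⟨j, i⟩ hx
    simp only [Finset.mem_product, Finset.mem_range] at hx ⊢
    split_ifs with hij <;> simp only at hij ⊢ <;> omega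
  · rintro ⟨j, i⟩ hx
    by_cases hij : i < j
    · have : ¬ j - 1 < i := by omega
      simp only [hij, this, if_true, if_false, Prod.mk.injEq, and_true]; omega
    · have : j < i + 1 := by omega
      simp [hij, this]

theorem TP_ext {n : ℕ} {W : Type*} [AddCommGroup W] [Module k W] {f g : TP k V (n + 1) →ₗ[k] W}
    (h : ∀ (t : TP k V n) (w : V), f (t ⊗ₜ[k] w : TP k V n ⊗[k] V) =
      g (t ⊗ₜ[k] w : TP k V n ⊗[k] V)) : f = g :=
  TensorProduct.ext' h

theorem lcons_ext {n : ℕ} {W : Type*} [AddCommGroup W] [Module k W]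
    {f g : TP k V (n + 1) →ₗ[k] W}
    (h : ∀ (v : V) (t : TP k V n), f (lcons n (v ⊗ₜ[k] t)) = g (lcons n (v ⊗ₜ[k] t))) :
    f = g := by
  have hfg : f ∘ₗ (lcons n).toLinearMap = g ∘ₗ (lcons n).toLinearMap := TensorProduct.ext' h
  ext x
  simpa using LinearMap.congr_fun hfg ((lcons n).symm x)

theorem oneTensor_lcons {p q : ℕ} (φ : TP k V p →ₗ[k] TP k V q) (v : V) (t : TP k V p) :
    oneTensor φ (lcons p (v ⊗ₜ[k] t)) = lcons q (v ⊗ₜ[k] φ t) := by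
  simp [oneTensor]

theorem oneTensor_eq_iff {p q : ℕ} {φ : TP k V p →ₗ[k] TP k V q}
    {ψ : TP k V (p + 1) →ₗ[k] TP k V (q + 1)} :
    oneTensor φ = ψ ↔ ∀ v : V, (lcons q).toLinearMap ∘ₗ TensorProduct.mk k V _ v ∘ₗ φ =
      ψ ∘ₗ (lcons p).toLinearMap ∘ₗ TensorProduct.mk k V _ v := by
  refine ⟨?_, fun h => lcons_ext fun v t => ?_⟩
  · rintro rfl v
    ext t
    exact (oneTensor_lcons φ v t).symm
  · rw [oneTensor_lcons]
    exact LinearMap.congr_fun (h v) t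

theorem oneTensor_mul {p : ℕ} (φ ψ : Module.End k (TP k V p)) :
    (oneTensor (φ * ψ) : Module.End k (TP k V (p + 1))) = oneTensor φ * oneTensor ψ :=
  lcons_ext fun v t => by
    rw [Module.End.mul_apply]
    simp only [oneTensor_lcons, Module.End.mul_apply]

theorem tensorOne_mul {p : ℕ} (φ ψ : Module.End k (TP k V p)) :
    (tensorOne (φ * ψ) : Module.End k (TP k V (p + 1))) = tensorOne φ * tensorOne ψ :=
  LinearMap.rTensor_mul V φ ψ

theorem oneTensor_tensorOne {p q : ℕ} (φ : TP k V p →ₗ[k] TP k V q) :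
    oneTensor (tensorOne φ) = tensorOne (oneTensor φ) :=
  oneTensor_eq_iff.2 fun v => TP_ext fun t w =>
    (congrArg (fun x => (x ⊗ₜ[k] w : TP k V (q + 1) ⊗[k] V)) (oneTensor_lcons φ v t)).symm

theorem sigmaMap_top (R : V ⊗[k] V →ₗ[k] V ⊗[k] V) (m : ℕ) :
    sigmaMap R (m + 2) (m + 2) = (TensorProduct.assoc k (TP k V m) V V).symm.toLinearMap ∘ₗ
        R.lTensor (TP k V m) ∘ₗ (TensorProduct.assoc k (TP k V m) V V).toLinearMap :=
  if_pos rfl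

theorem tensorOne_sigmaMap (R : V ⊗[k] V →ₗ[k] V ⊗[k] V) {m i : ℕ} (hi : 1 ≤ i) (him : i ≤ m) :
    tensorOne (sigmaMap R m i) = sigmaMap R (m + 1) i := by
  obtain _ | m := m
  · omega
  · exact (if_neg (by omega)).symm

theorem lcons_assoc_symm (m : ℕ) (v : V) (t : TP k V m) (r : V ⊗[k] V) :
    lcons (m + 2) (v ⊗ₜ[k] (TensorProduct.assoc k (TP k V m) V V).symm (t ⊗ₜ[k] r)) =
      (TensorProduct.assoc k (TP k V (m + 1)) V V).symm (lcons m (v ⊗ₜ[k] t) ⊗ₜ[k] r) := by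
  have : (lcons (m + 2)).toLinearMap ∘ₗ TensorProduct.mk k V _ v ∘ₗ
      (TensorProduct.assoc k (TP k V m) V V).symm.toLinearMap ∘ₗ TensorProduct.mk k _ _ t =
      (TensorProduct.assoc k (TP k V (m + 1)) V V).symm.toLinearMap ∘ₗ
        TensorProduct.mk k _ _ (lcons m (v ⊗ₜ[k] t)) := TensorProduct.ext' fun _ _ => rfl
  exact LinearMap.congr_fun this r

theorem oneTensor_sigmaMap (R : V ⊗[k] V →ₗ[k] V ⊗[k] V) {m i : ℕ} (hi : 1 ≤ i) (him : i ≤ m) :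
    oneTensor (sigmaMap R m i) = sigmaMap R (m + 1) (i + 1) := by
  induction m with
  | zero => omega
  | succ m ih =>
    obtain him | rfl := Nat.lt_or_eq_of_le him
    · rw [← tensorOne_sigmaMap R hi (by omega), oneTensor_tensorOne, ih (by omega),
        tensorOne_sigmaMap R (by omega) (by omega)]
    · rw [sigmaMap_top]
      refine oneTensor_eq_iff.2 fun v => ?_
      obtain _ | m := m
      · refine TP_ext fun t w => ?_
        have h : ∀ r : V ⊗[k] V, lcons 1 (v ⊗ₜ[k] (r : TP k V 1)) =
            (TensorProduct.assoc k (TP k V 0) V V).symm (v ⊗ₜ[k] r) := fun r =>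
          LinearMap.congr_fun (show (lcons 1).toLinearMap ∘ₗ TensorProduct.mk k V (V ⊗[k] V) v =
            (TensorProduct.assoc k V V V).symm.toLinearMap ∘ₗ TensorProduct.mk k _ _ v from
              TensorProduct.ext' fun _ _ => rfl) r
        exact h (R (t ⊗ₜ[k] w))
      · rw [sigmaMap_top]
        refine TensorProduct.ext_threefold fun t x y => ?_
        exact lcons_assoc_symm m v t (R (x ⊗ₜ[k] y))

theorem sigmaMap_top_mul_tensorOne (R : V ⊗[k] V →ₗ[k] V ⊗[k] V) {m : ℕ}
    (φ : Module.End k (TP k V m)) :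
    (sigmaMap R (m + 2) (m + 2) * tensorOne (tensorOne φ) : Module.End k (TP k V (m + 2))) =
      tensorOne (tensorOne φ) * sigmaMap R (m + 2) (m + 2) := by
  rw [sigmaMap_top]
  refine TensorProduct.ext_threefold fun t x y => ?_
  have h : tensorOne (tensorOne φ) ∘ₗ
      (TensorProduct.assoc k (TP k V m) V V).symm.toLinearMap ∘ₗ TensorProduct.mk k _ _ t =
      (TensorProduct.assoc k (TP k V m) V V).symm.toLinearMap ∘ₗ TensorProduct.mk k _ _ (φ t) :=
    TensorProduct.ext' fun _ _ => rfl
  exact (LinearMap.congr_fun h (R (x ⊗ₜ[k] y))).symm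

/-- The canonical map `V^{⊗(m+1)} → Hom(V ⊗ V, V^{⊗(m+3)})` prepending two tensor factors. -/
def lconsTwo (m : ℕ) : TP k V m →ₗ[k] V ⊗[k] V →ₗ[k] TP k V (m + 2) :=
  ((TensorProduct.mk k (V ⊗[k] V) (TP k V m)).compr₂ ((lcons (m + 1)).toLinearMap ∘ₗ
    (lcons m).toLinearMap.lTensor V ∘ₗ (TensorProduct.assoc k V V (TP k V m)).toLinearMap)).flip

theorem lconsTwo_tmul (m : ℕ) (t : TP k V m) (v w : V) :
    lconsTwo m t (v ⊗ₜ[k] w) = lcons (m + 1) (v ⊗ₜ[k] lcons m (w ⊗ₜ[k] t)) :=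
  rfl

theorem lconsTwo_succ_tmul (m : ℕ) (t : TP k V m) (w : V) (r : V ⊗[k] V) :
    lconsTwo (m + 1) (t ⊗ₜ[k] w : TP k V m ⊗[k] V) r =
      (lconsTwo m t r ⊗ₜ[k] w : TP k V (m + 2) ⊗[k] V) :=
  LinearMap.congr_fun (show lconsTwo (m + 1) (t ⊗ₜ[k] w : TP k V m ⊗[k] V) =
    (TensorProduct.mk k (TP k V (m + 2)) V).flip w ∘ₗ lconsTwo m t from
      TensorProduct.ext' fun _ _ => rfl) r

theorem lconsTwo_ext {m : ℕ} {W : Type*} [AddCommGroup W] [Module k W]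
    {f g : TP k V (m + 2) →ₗ[k] W} (h : ∀ t r, f (lconsTwo m t r) = g (lconsTwo m t r)) :
    f = g :=
  lcons_ext fun v t => LinearMap.congr_fun
    (lcons_ext (f := f ∘ₗ (lcons (m + 1)).toLinearMap ∘ₗ TensorProduct.mk k V _ v)
      (g := g ∘ₗ (lcons (m + 1)).toLinearMap ∘ₗ TensorProduct.mk k V _ v)
      fun w t => h t (v ⊗ₜ[k] w)) t

theorem oneTensor_oneTensor_lconsTwo {m : ℕ} (φ : Module.End k (TP k V m)) (t : TP k V m)
    (r : V ⊗[k] V) : oneTensor (oneTensor φ) (lconsTwo m t r) = lconsTwo m (φ t) r :=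
  LinearMap.congr_fun (show oneTensor (oneTensor φ) ∘ₗ lconsTwo m t = lconsTwo m (φ t) from
    TensorProduct.ext' fun v w => by
      rw [LinearMap.comp_apply, lconsTwo_tmul, oneTensor_lcons, oneTensor_lcons,
        lconsTwo_tmul]) r

theorem sigmaMap_one_lconsTwo (R : V ⊗[k] V →ₗ[k] V ⊗[k] V) (m : ℕ) (t : TP k V m)
    (r : V ⊗[k] V) : sigmaMap R (m + 2) 1 (lconsTwo m t r) = lconsTwo m t (R r) := by
  induction m generalizing r with
  | zero =>
    have h : ∀ r : V ⊗[k] V, lconsTwo 0 t r = (r ⊗ₜ[k] (t : V) : (V ⊗[k] V) ⊗[k] V) := fun r =>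
      LinearMap.congr_fun (show lconsTwo 0 t = (TensorProduct.mk k (V ⊗[k] V) V).flip t from
        TensorProduct.ext' fun _ _ => rfl) r
    rw [h, h]
    rfl
  | succ m ih =>
    rw [← tensorOne_sigmaMap R le_rfl (by omega)]
    refine LinearMap.congr_fun (f := tensorOne (sigmaMap R (m + 2) 1) ∘ₗ
      (lconsTwo (m + 1)).flip r) (g := (lconsTwo (m + 1)).flip (R r)) (TP_ext fun t w => ?_) t
    exact (congrArg (tensorOne (sigmaMap R (m + 2) 1)) (lconsTwo_succ_tmul m t w r)).trans
      ((congrArg (fun x => (x ⊗ₜ[k] w : TP k V (m + 2) ⊗[k] V)) (ih t r)).trans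
        (lconsTwo_succ_tmul m t w (R r)).symm)

theorem sigmaMap_one_mul_oneTensor (R : V ⊗[k] V →ₗ[k] V ⊗[k] V) {m : ℕ}
    (φ : Module.End k (TP k V m)) :
    (sigmaMap R (m + 2) 1 * oneTensor (oneTensor φ) : Module.End k (TP k V (m + 2))) =
      oneTensor (oneTensor φ) * sigmaMap R (m + 2) 1 :=
  lconsTwo_ext fun t r => by
    rw [Module.End.mul_apply, Module.End.mul_apply, oneTensor_oneTensor_lconsTwo,
      sigmaMap_one_lconsTwo, sigmaMap_one_lconsTwo, oneTensor_oneTensor_lconsTwo]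

theorem sigmaMap_comm (R : V ⊗[k] V →ₗ[k] V ⊗[k] V) {m i j : ℕ} (hi : 1 ≤ i) (hij : i + 2 ≤ j)
    (hj : j ≤ m) :
    (sigmaMap R m i * sigmaMap R m j : Module.End k (TP k V m)) =
      sigmaMap R m j * sigmaMap R m i := by
  induction m with
  | zero => omega
  | succ m ih =>
    obtain hj | rfl := Nat.lt_or_eq_of_le hj
    · rw [← tensorOne_sigmaMap R hi (by omega), ← tensorOne_sigmaMap R (by omega) (by omega),
        ← tensorOne_mul, ih (by omega), tensorOne_mul]
    · obtain ⟨m, rfl⟩ : ∃ n, m = n + 1 := ⟨m - 1, by omega⟩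
      rw [← tensorOne_sigmaMap R hi (by omega), ← tensorOne_sigmaMap R hi (by omega)]
      exact (sigmaMap_top_mul_tensorOne R _).symm

theorem sigmaMap_braid (R : V ⊗[k] V →ₗ[k] V ⊗[k] V)
    (hYB : (sigmaMap R 2 1 * sigmaMap R 2 2 * sigmaMap R 2 1 : Module.End k (TP k V 2)) =
      sigmaMap R 2 2 * sigmaMap R 2 1 * sigmaMap R 2 2)
    {m i : ℕ} (hi : 1 ≤ i) (him : i + 1 ≤ m) :
    (sigmaMap R m i * sigmaMap R m (i + 1) * sigmaMap R m i : Module.End k (TP k V m)) =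
      sigmaMap R m (i + 1) * sigmaMap R m i * sigmaMap R m (i + 1) := by
  induction m generalizing i with
  | zero => omega
  | succ m ih =>
    obtain him | him := Nat.lt_or_eq_of_le him
    · rw [← tensorOne_sigmaMap R hi (by omega), ← tensorOne_sigmaMap R (by omega) (by omega)]
      simp only [← tensorOne_mul]
      rw [ih hi (by omega)]
    · obtain rfl | hi := hi.eq_or_lt
      · obtain rfl : m = 1 := by omega
        exact hYB
      · obtain ⟨i, rfl⟩ : ∃ n, i = n + 1 := ⟨i - 1, by omega⟩
        rw [← oneTensor_sigmaMap R (by omega) (by omega),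
          ← oneTensor_sigmaMap R (by omega) (by omega)]
        simp only [← oneTensor_mul]
        rw [ih (by omega) (by omega)]

theorem sigmaComp_eq_prod (R : V ⊗[k] V →ₗ[k] V ⊗[k] V) (n : ℕ) (l : List ℕ) :
    sigmaComp R n l = (l.map fun i => (sigmaMap R n i : Module.End k (TP k V n))).prod := by
  induction l with
  | nil => rfl
  | cons a l ih =>
    rw [List.map_cons, List.prod_cons, ← ih]
    rfl

theorem oneTensor_sigmaComp (R : V ⊗[k] V →ₗ[k] V ⊗[k] V) {m : ℕ} {l : List ℕ}
    (hl : ∀ i ∈ l, 1 ≤ i ∧ i ≤ m) :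
    oneTensor (sigmaComp R m l) = sigmaComp R (m + 1) (l.map (· + 1)) := by
  induction l with
  | nil =>
    exact lcons_ext fun v t => by rw [oneTensor_lcons]; rfl
  | cons a l ih =>
    have ha := hl a (by simp)
    refine (oneTensor_mul (sigmaMap R m a) (sigmaComp R m l)).trans ?_
    rw [ih fun i hi => hl i (by simp [hi]), oneTensor_sigmaMap R ha.1 ha.2]
    rfl

theorem tensorOne_sigmaComp (R : V ⊗[k] V →ₗ[k] V ⊗[k] V) {m : ℕ} {l : List ℕ}
    (hl : ∀ i ∈ l, 1 ≤ i ∧ i ≤ m) :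
    tensorOne (sigmaComp R m l) = sigmaComp R (m + 1) l := by
  induction l with
  | nil => exact LinearMap.rTensor_id V _
  | cons a l ih =>
    have ha := hl a (by simp)
    refine (tensorOne_mul (sigmaMap R m a) (sigmaComp R m l)).trans ?_
    rw [ih fun i hi => hl i (by simp [hi]), tensorOne_sigmaMap R ha.1 ha.2]
    rfl

theorem braidRelations_sigmaMap (R : V ⊗[k] V →ₗ[k] V ⊗[k] V)
    (hYB : (sigmaMap R 2 1 * sigmaMap R 2 2 * sigmaMap R 2 1 : Module.End k (TP k V 2)) =
      sigmaMap R 2 2 * sigmaMap R 2 1 * sigmaMap R 2 2) (m : ℕ) :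
    BraidRelations (fun i => (sigmaMap R m i : Module.End k (TP k V m))) m where
  comm _ _ := sigmaMap_comm R
  braid _ := sigmaMap_braid R hYB

theorem oneTensor_add {p : ℕ} (φ ψ : Module.End k (TP k V p)) :
    oneTensor (φ + ψ) = oneTensor φ + oneTensor ψ :=
  lcons_ext fun v t => by
    rw [LinearMap.add_apply]
    simp only [oneTensor_lcons, LinearMap.add_apply, TensorProduct.tmul_add, map_add]

theorem tensorOne_add {p : ℕ} (φ ψ : Module.End k (TP k V p)) :
    tensorOne (φ + ψ) = tensorOne φ + tensorOne ψ :=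
  LinearMap.rTensor_add V φ ψ

/-- The summand of `dYBi` in which the new strand is added on the left. -/
def leftCoface (R : V ⊗[k] V →ₗ[k] V ⊗[k] V) (p i : ℕ) :
    Module.End k (TP k V p) →+ Module.End k (TP k V (p + 1)) :=
  AddMonoidHom.mk' (fun φ =>
    (sigmaComp R (p + 1) (List.Ico 1 i).reverse : Module.End k (TP k V (p + 1))) * oneTensor φ *
      sigmaComp R (p + 1) (List.Ico 1 (p + 3 - i))) fun φ ψ => by
    rw [oneTensor_add, mul_add, add_mul]

/-- The summand of `dYBi` in which the new strand is added on the right. -/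
def rightCoface (R : V ⊗[k] V →ₗ[k] V ⊗[k] V) (p i : ℕ) :
    Module.End k (TP k V p) →+ Module.End k (TP k V (p + 1)) :=
  AddMonoidHom.mk' (fun φ =>
    (sigmaComp R (p + 1) (List.Ico i (p + 2)) : Module.End k (TP k V (p + 1))) * tensorOne φ *
      sigmaComp R (p + 1) (List.Ico (p + 3 - i) (p + 2)).reverse) fun φ ψ => by
    rw [tensorOne_add, mul_add, add_mul]

theorem leftCoface_apply (R : V ⊗[k] V →ₗ[k] V ⊗[k] V) (p i : ℕ) (φ : Module.End k (TP k V p)) :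
    leftCoface R p i φ =
      (sigmaComp R (p + 1) (List.Ico 1 i).reverse : Module.End k (TP k V (p + 1))) *
        oneTensor φ * sigmaComp R (p + 1) (List.Ico 1 (p + 3 - i)) :=
  rfl

theorem rightCoface_apply (R : V ⊗[k] V →ₗ[k] V ⊗[k] V) (p i : ℕ)
    (φ : Module.End k (TP k V p)) :
    rightCoface R p i φ =
      (sigmaComp R (p + 1) (List.Ico i (p + 2)) : Module.End k (TP k V (p + 1))) *
        tensorOne φ * sigmaComp R (p + 1) (List.Ico (p + 3 - i) (p + 2)).reverse :=
  rfl

theorem dYBi_eq_sub (R : V ⊗[k] V →ₗ[k] V ⊗[k] V) {p i : ℕ} (hi : 1 ≤ i) (hip : i ≤ p + 2)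
    (φ : Module.End k (TP k V p)) :
    dYBi R p i φ = leftCoface R p i φ - rightCoface R p i φ := by
  rw [leftCoface_apply, rightCoface_apply, List.Ico, List.Ico, List.Ico, List.Ico,
    show p + 3 - i = p + 2 - i + 1 by omega, Nat.add_sub_cancel,
    show p + 2 - (p + 2 - i + 1) = i - 1 by omega]
  rfl

theorem mul_sandwich_eq {M : Type*} [Monoid M] {a b c d a' b' c' d' x t : M}
    (hl : a * b = a' * b' * t) (hr : c' * d' = t * (c * d)) (hx : t * x = x * t) :
    a * (b * x * c) * d = a' * (b' * x * c') * d' :=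
  calc a * (b * x * c) * d = a * b * x * (c * d) := by simp only [mul_assoc]
    _ = a' * b' * (t * x) * (c * d) := by rw [hl]; simp only [mul_assoc]
    _ = a' * b' * x * (c' * d') := by rw [hx, hr]; simp only [mul_assoc]
    _ = a' * (b' * x * c') * d' := by simp only [mul_assoc]

theorem leftCoface_leftCoface (R : V ⊗[k] V →ₗ[k] V ⊗[k] V)
    (hYB : (sigmaMap R 2 1 * sigmaMap R 2 2 * sigmaMap R 2 1 : Module.End k (TP k V 2)) =
      sigmaMap R 2 2 * sigmaMap R 2 1 * sigmaMap R 2 2)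
    {p i j : ℕ} (hi : 1 ≤ i) (hij : i ≤ j) (hj : j ≤ p + 2) (φ : Module.End k (TP k V p)) :
    leftCoface R (p + 1) (j + 1) (leftCoface R p i φ) =
    leftCoface R (p + 1) i (leftCoface R p j φ) := by
  have hB := braidRelations_sigmaMap R hYB (p + 1 + 1)
  simp only [leftCoface_apply, oneTensor_mul]
  rw [oneTensor_sigmaComp R (by simp; omega), oneTensor_sigmaComp R (by simp; omega),
    oneTensor_sigmaComp R (by simp; omega), oneTensor_sigmaComp R (by simp; omega)]
  simp only [List.map_reverse (f := (· + 1)), BraidRelations.map_succ_Ico, sigmaComp_eq_prod]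
  rw [show p + 1 + 3 - (j + 1) = p + 3 - j by omega, show p + 1 + 3 - i = p + 3 - i + 1 by omega]
  refine mul_sandwich_eq (t := sigmaMap R (p + 2) 1) ?_ ?_ (sigmaMap_one_mul_oneTensor R φ)
  · refine (hB.prod_reverse_Ico_mul (a := 1) (b := j + 1) (c := 1) (d := i) le_rfl (by omega)
      le_rfl (by omega)).symm.trans ?_
    rw [List.Ico.eq_cons (by omega : 1 < j + 1), mul_assoc]
    simp
  · refine (hB.prod_Ico_mul_prod_Ico (a := 1) (b := p + 3 - i + 1) (c := 1) (d := p + 3 - j)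
      le_rfl (by omega) le_rfl (by omega)).symm.trans ?_
    rw [List.Ico.eq_cons (by omega : 1 < p + 3 - i + 1), ← mul_assoc]
    simp

theorem leftCoface_rightCoface (R : V ⊗[k] V →ₗ[k] V ⊗[k] V)
    (hYB : (sigmaMap R 2 1 * sigmaMap R 2 2 * sigmaMap R 2 1 : Module.End k (TP k V 2)) =
      sigmaMap R 2 2 * sigmaMap R 2 1 * sigmaMap R 2 2)
    {p i j : ℕ} (hi : 1 ≤ i) (hij : i ≤ j) (hj : j ≤ p + 2) (φ : Module.End k (TP k V p)) :
    leftCoface R (p + 1) (j + 1) (rightCoface R p i φ) =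
    rightCoface R (p + 1) i (leftCoface R p j φ) := by
  have hB := braidRelations_sigmaMap R hYB (p + 1 + 1)
  simp only [leftCoface_apply, rightCoface_apply, oneTensor_mul, tensorOne_mul]
  rw [oneTensor_sigmaComp R (by simp; omega), oneTensor_sigmaComp R (by simp; omega),
    tensorOne_sigmaComp R (by simp; omega), tensorOne_sigmaComp R (by simp; omega),
    oneTensor_tensorOne]
  simp only [List.map_reverse (f := (· + 1)), BraidRelations.map_succ_Ico, sigmaComp_eq_prod]
  rw [show p + 1 + 3 - (j + 1) = p + 3 - j by omega, show p + 1 + 3 - i = p + 3 - i + 1 by omega]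
  refine mul_sandwich_eq (t := 1) ?_ ?_ (by rw [one_mul, mul_one])
  · rw [mul_one]
    exact (hB.prod_Ico_mul_reverse hi hij (by omega) (by omega)).symm
  · rw [one_mul]
    exact hB.prod_mul_prod_comm (by simp; omega) (by simp; omega) (by simp; omega)

theorem rightCoface_leftCoface (R : V ⊗[k] V →ₗ[k] V ⊗[k] V)
    (hYB : (sigmaMap R 2 1 * sigmaMap R 2 2 * sigmaMap R 2 1 : Module.End k (TP k V 2)) =
      sigmaMap R 2 2 * sigmaMap R 2 1 * sigmaMap R 2 2)
    {p i j : ℕ} (hi : 1 ≤ i) (hij : i ≤ j) (hj : j ≤ p + 2) (φ : Module.End k (TP k V p)) :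
    rightCoface R (p + 1) (j + 1) (leftCoface R p i φ) =
    leftCoface R (p + 1) i (rightCoface R p j φ) := by
  have hB := braidRelations_sigmaMap R hYB (p + 1 + 1)
  simp only [leftCoface_apply, rightCoface_apply, oneTensor_mul, tensorOne_mul]
  rw [oneTensor_sigmaComp R (by simp; omega), oneTensor_sigmaComp R (by simp; omega),
    tensorOne_sigmaComp R (by simp; omega), tensorOne_sigmaComp R (by simp; omega),
    oneTensor_tensorOne]
  simp only [List.map_reverse (f := (· + 1)), BraidRelations.map_succ_Ico, sigmaComp_eq_prod]
  rw [show p + 1 + 3 - (j + 1) = p + 3 - j by omega, show p + 1 + 3 - i = p + 3 - i + 1 by omega]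
  refine mul_sandwich_eq (t := 1) ?_ ?_ (by rw [one_mul, mul_one])
  · rw [mul_one]
    exact (hB.prod_mul_prod_comm (by simp; omega) (by simp; omega) (by simp; omega)).symm
  · rw [one_mul]
    exact (hB.prod_Ico_mul_reverse_Ico (by omega) (by omega) (by omega) (by omega)).symm

theorem rightCoface_rightCoface (R : V ⊗[k] V →ₗ[k] V ⊗[k] V)
    (hYB : (sigmaMap R 2 1 * sigmaMap R 2 2 * sigmaMap R 2 1 : Module.End k (TP k V 2)) =
      sigmaMap R 2 2 * sigmaMap R 2 1 * sigmaMap R 2 2)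
    {p i j : ℕ} (hi : 1 ≤ i) (hij : i ≤ j) (hj : j ≤ p + 2) (φ : Module.End k (TP k V p)) :
    rightCoface R (p + 1) (j + 1) (rightCoface R p i φ) =
    rightCoface R (p + 1) i (rightCoface R p j φ) := by
  have hB := braidRelations_sigmaMap R hYB (p + 1 + 1)
  simp only [rightCoface_apply, tensorOne_mul]
  rw [tensorOne_sigmaComp R (by simp; omega), tensorOne_sigmaComp R (by simp; omega),
    tensorOne_sigmaComp R (by simp; omega), tensorOne_sigmaComp R (by simp; omega)]
  simp only [sigmaComp_eq_prod]
  rw [show p + 1 + 3 - (j + 1) = p + 3 - j by omega, show p + 1 + 3 - i = p + 3 - i + 1 by omega]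
  refine (mul_sandwich_eq (t := sigmaMap R (p + 2) (p + 2)) ?_ ?_
    (sigmaMap_top_mul_tensorOne R φ)).symm
  · refine (hB.prod_Ico_mul_prod_Ico (a := i) (b := p + 1 + 2) (c := j) (d := p + 2) hi
      (by omega) hij (by omega)).trans ?_
    rw [List.Ico.succ_top (by omega : i ≤ p + 1 + 1), mul_assoc]
    simp
  · refine (hB.prod_reverse_Ico_mul (a := p + 3 - j) (b := p + 1 + 2) (c := p + 3 - i)
      (d := p + 2) (by omega) (by omega) (by omega) (by omega)).trans ?_
    rw [List.Ico.succ_top (by omega : p + 3 - j ≤ p + 1 + 1), ← mul_assoc]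
    simp

/-- for a solution `R` of the Yang-Baxter equation (not assumed
invertible), the Yang-Baxter differentials `d^n_YB` on
`Hom(V^{⊗n}, V^{⊗n})`, `n ≥ 1`, form a cochain complex:
`d^{n+1}_YB ∘ d^n_YB = 0`.  Here `n = p + 1` ranges over all integers `≥ 1`. -/
theorem dYB_dYB_eq_zero (R : V ⊗[k] V →ₗ[k] V ⊗[k] V)
    (hYB : R.rTensor V ∘ₗ ((TensorProduct.assoc k V V V).symm.toLinearMap ∘ₗ
        R.lTensor V ∘ₗ (TensorProduct.assoc k V V V).toLinearMap) ∘ₗ R.rTensor V =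
      ((TensorProduct.assoc k V V V).symm.toLinearMap ∘ₗ R.lTensor V ∘ₗ
        (TensorProduct.assoc k V V V).toLinearMap) ∘ₗ R.rTensor V ∘ₗ
        ((TensorProduct.assoc k V V V).symm.toLinearMap ∘ₗ R.lTensor V ∘ₗ
          (TensorProduct.assoc k V V V).toLinearMap))
    (p : ℕ) (φ : TP k V p →ₗ[k] TP k V p) :
    dYB R (p + 1) (dYB R p φ) = 0 := by
  have hB : (sigmaMap R 2 1 * sigmaMap R 2 2 * sigmaMap R 2 1 : Module.End k (TP k V 2)) =
      sigmaMap R 2 2 * sigmaMap R 2 1 * sigmaMap R 2 2 := by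
    rw [mul_assoc, mul_assoc]
    exact hYB
  have hd : ∀ (q : ℕ) (ψ : Module.End k (TP k V q)), dYB R q ψ =
      ∑ j ∈ Finset.range (q + 2),
        ((-1 : ℤ) ^ j) • (leftCoface R q (j + 1) - rightCoface R q (j + 1)) ψ := fun q ψ =>
    Finset.sum_congr rfl fun j hj => by
      rw [dYBi_eq_sub R (by omega) (by simp at hj; omega), AddMonoidHom.sub_apply]
  rw [hd, hd]
  simp only [map_sum, map_zsmul, Finset.smul_sum, smul_smul, ← pow_add]
  refine sum_sum_neg_one_pow_smul_eq_zero (p + 2) (fun j i =>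
    (leftCoface R (p + 1) (j + 1) - rightCoface R (p + 1) (j + 1))
      ((leftCoface R p (i + 1) - rightCoface R p (i + 1)) φ)) fun i j hij hj => ?_
  obtain ⟨j, rfl⟩ : ∃ n, j = n + 1 := ⟨j - 1, by omega⟩
  have h1 : 1 ≤ i + 1 := by omega
  have h2 : i + 1 ≤ j + 1 := by omega
  have h3 : j + 1 ≤ p + 2 := by omega
  simp only [Nat.add_sub_cancel, AddMonoidHom.sub_apply, map_sub,
    leftCoface_leftCoface R hB h1 h2 h3, leftCoface_rightCoface R hB h1 h2 h3,
    rightCoface_leftCoface R hB h1 h2 h3, rightCoface_rightCoface R hB h1 h2 h3]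
  abel

end
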